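/- Second No-Go Theorem: Let L be classical propositional logic with its usual derivability relation ⊢_L. Then no continuous and non-refusing censor is at the same time effective and minimally invasive. -/

import Mathlib

/-- A logic: a set (type) of formulas with a consequence relation satisfying
reflexivity, weakening and transitivity (cut). -/
structure Logic where
  Fml : Type
  Proves : Set Fml → Fml → Prop
  refl : ∀ A : Fml, Proves {A} A
  weaken : ∀ (Γ Δ : Set Fml) (A : Fml), Proves Γ A → Proves (Γ ∪ Δ) A
  cut : ∀ (Γ Δ : Set Fml) (C A : Fml),
    Proves Γ C → Proves (Δ ∪ {C}) A → Proves (Γ ∪ Δ) A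

/-- Modal formulas over a logic `L`: boxed `L`-formulas, falsum, implication. -/
inductive MFml (L : Logic) : Type where
  | box : L.Fml → MFml L
  | bot : MFml L
  | imp : MFml L → MFml L → MFml L

/-- ¬A := A → ⊥ -/
def MFml.neg {L : Logic} (A : MFml L) : MFml L := MFml.imp A MFml.bot

/-- ⊤ := ⊥ → ⊥ -/
def MFml.top {L : Logic} : MFml L := MFml.imp MFml.bot MFml.bot

/-- A ∨ B := ¬A → B -/
def MFml.or {L : Logic} (A B : MFml L) : MFml L := MFml.imp (MFml.neg A) B

/-- An M-model is a set of sets of `L`-formulas. -/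
abbrev MModel (L : Logic) := Set (Set L.Fml)

/-- Truth of a modal formula in an M-model. -/
def Sat {L : Logic} (M : MModel L) : MFml L → Prop
  | MFml.box A => ∀ w ∈ M, L.Proves w A
  | MFml.bot => False
  | MFml.imp A B => Sat M A → Sat M B

/-- `M ⊩ Γ`. -/
def SatSet {L : Logic} (M : MModel L) (Γ : Set (MFml L)) : Prop :=
  ∀ A ∈ Γ, Sat M A

/-- Γ is satisfiable. -/
def Satisfiable {L : Logic} (Γ : Set (MFml L)) : Prop :=
  ∃ M : MModel L, SatSet M Γ

/-- Γ ⊨ A. -/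
def Entails {L : Logic} (Γ : Set (MFml L)) (A : MFml L) : Prop :=
  ∀ M : MModel L, SatSet M Γ → Sat M A

/-- A privacy configuration (KB, AK, Sec). -/
structure PrivacyConfig (L : Logic) where
  KB : Set L.Fml
  AK : Set (MFml L)
  Sec : Set L.Fml
  consistent : ∃ A : L.Fml, ¬ L.Proves KB A
  truthfulStart : ∀ A ∈ AK, Sat ({KB} : MModel L) A
  hiddenSecrets : ∀ s ∈ Sec, ¬ Entails AK (MFml.box s)

/-- The answers 𝔸 = {t, u, r}. -/
inductive Ans : Type
  | t | u | r
deriving DecidableEq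

open Classical in
/-- eval(KB, q) := t if KB ⊢ q and u otherwise. -/
noncomputable def evalKB (L : Logic) (KB : Set L.Fml) (q : L.Fml) : Ans :=
  if L.Proves KB q then Ans.t else Ans.u

/-- A censor assigns an answering function (on infinite query sequences,
indexed by ℕ) to each privacy configuration. -/
abbrev Censor (L : Logic) := PrivacyConfig L → (ℕ → L.Fml) → (ℕ → Ans)

/-- A censor is continuous iff answers on an initial segment only depend on
the queries in that initial segment. -/
def ContinuousCensor {L : Logic} (Cens : Censor L) : Prop :=
  ∀ (PK : PrivacyConfig L) (q q' : ℕ → L.Fml) (n : ℕ),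
    (∀ i < n, q i = q' i) → ∀ i < n, Cens PK q i = Cens PK q' i

/-- A censor is truthful iff each answer is either the correct evaluation or refusal. -/
def Truthful {L : Logic} (Cens : Censor L) : Prop :=
  ∀ (PK : PrivacyConfig L) (q : ℕ → L.Fml) (i : ℕ),
    Cens PK q i = evalKB L PK.KB (q i) ∨ Cens PK q i = Ans.r

/-- Content of an answer to a query. -/
def contAns {L : Logic} (q : L.Fml) : Ans → MFml L
  | Ans.t => MFml.box q
  | Ans.u => MFml.neg (MFml.box q)
  | Ans.r => MFml.top

/-- The content of the answers of a censor to a query sequence up to `n`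
(0-based: queries with index `< n`), including the a priori knowledge. -/
def cont {L : Logic} (Cens : Censor L) (PK : PrivacyConfig L)
    (q : ℕ → L.Fml) (n : ℕ) : Set (MFml L) :=
  {F | ∃ i < n, F = contAns (q i) (Cens PK q i)} ∪ PK.AK

/-- The full content of a knowledge base. -/
noncomputable def fullContent (L : Logic) (KB : Set L.Fml) : Set (MFml L) :=
  {F | ∃ A : L.Fml, F = contAns A (evalKB L KB A)}

/-- A censor is credible iff the content of its answers is always satisfiable. -/
def Credible {L : Logic} (Cens : Censor L) : Prop :=
  ∀ (PK : PrivacyConfig L) (q : ℕ → L.Fml) (n : ℕ), Satisfiable (cont Cens PK q n)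

/-- A censor is effective iff the content of its answers never entails a boxed secret. -/
def Effective {L : Logic} (Cens : Censor L) : Prop :=
  ∀ (PK : PrivacyConfig L) (q : ℕ → L.Fml) (n : ℕ),
    ∀ s ∈ PK.Sec, ¬ Entails (cont Cens PK q n) (MFml.box s)

/-- A censor is minimally invasive iff whenever it distorts an answer,
replacing that answer by the correct evaluation (keeping the earlier answers)
would violate effectiveness or credibility. -/
def MinimallyInvasive {L : Logic} (Cens : Censor L) : Prop :=
  ∀ (PK : PrivacyConfig L) (q : ℕ → L.Fml) (i : ℕ),
    Cens PK q i ≠ evalKB L PK.KB (q i) →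
    ∀ Cens' : Censor L,
      (∀ j < i, Cens' PK q j = Cens PK q j) →
      Cens' PK q i = evalKB L PK.KB (q i) →
      ∃ n : ℕ,
        (∃ s ∈ PK.Sec, Entails (cont Cens' PK q n) (MFml.box s)) ∨
        ¬ Satisfiable (cont Cens' PK q n)

/-- A censor is repudiating iff for every privacy configuration and query
sequence there are alternative knowledge bases, not entailing any secret,
producing the same answers on each initial segment. -/
def Repudiating {L : Logic} (Cens : Censor L) : Prop :=
  ∀ (PK : PrivacyConfig L) (q : ℕ → L.Fml),
    ∃ PKs : ℕ → PrivacyConfig L,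
      (∀ i, (PKs i).AK = PK.AK ∧ (PKs i).Sec = PK.Sec) ∧
      (∀ n, ∀ i < n, Cens PK q i = Cens (PKs n) q i) ∧
      (∀ i, ∀ s ∈ PK.Sec, ¬ L.Proves (PKs i).KB s)

/-- A censor is non-refusing iff it never answers `r`. -/
def NonRefusing {L : Logic} (Cens : Censor L) : Prop :=
  ∀ (PK : PrivacyConfig L) (q : ℕ → L.Fml) (i : ℕ), Cens PK q i ≠ Ans.r

/-- Classical propositional formulas over countably many atomic propositions. -/
inductive PropFml : Type
  | atom : ℕ → PropFml
  | bot : PropFml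
  | imp : PropFml → PropFml → PropFml

/-- Classical negation ¬A := A → ⊥ on the propositional level. -/
def PropFml.neg (A : PropFml) : PropFml := PropFml.imp A PropFml.bot

/-- Truth of a propositional formula under a valuation. -/
def evalP (v : ℕ → Prop) : PropFml → Prop
  | PropFml.atom n => v n
  | PropFml.bot => False
  | PropFml.imp A B => evalP v A → evalP v B

/-- Classical propositional consequence (derivability = semantic consequence). -/
def PropProves (Γ : Set PropFml) (A : PropFml) : Prop :=
  ∀ v : ℕ → Prop, (∀ B ∈ Γ, evalP v B) → evalP v A

/-- Classical propositional logic as a `Logic`. -/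
def PropLogic : Logic where
  Fml := PropFml
  Proves := PropProves
  refl := by
    intro A v h
    exact h A rfl
  weaken := by
    intro Γ Δ A hΓ v h
    exact hΓ v fun B hB => h B (Set.mem_union_left Δ hB)
  cut := by
    intro Γ Δ C A hC hA v h
    refine hA v fun B hB => ?_
    rcases hB with hB | hB
    · exact h B (Set.mem_union_right Γ hB)
    · cases hB
      exact hC v fun B' hB' => h B' (Set.mem_union_left Δ hB')


/-- The configuration KB = {a}, AK = {□a ∨ □b}, Sec = {a, b}. -/
def badPK : PrivacyConfig PropLogic where
  KB := ({PropFml.atom 0} : Set PropFml)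
  AK := {MFml.or (MFml.box (L := PropLogic) (PropFml.atom 0))
    (MFml.box (L := PropLogic) (PropFml.atom 1))}
  Sec := ({PropFml.atom 0, PropFml.atom 1} : Set PropFml)
  consistent := by
    refine ⟨PropFml.bot, fun h => h (fun _ => True) ?_⟩
    intro B hB
    cases hB
    trivial
  truthfulStart := by
    intro A hA
    cases hA
    intro hn
    refine (hn ?_).elim
    intro w hw
    cases hw
    exact PropLogic.refl _
  hiddenSecrets := by
    intro s hs h
    rcases hs with hs | hs
    · cases hs
      have h1 := h ({({PropFml.atom 1} : Set PropFml)} : Set (Set PropFml)) (by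
        intro A hA
        cases hA
        intro _ w hw
        cases hw
        exact PropLogic.refl _) _ rfl
      have h2 : (0 : ℕ) = 1 := h1 (fun n => n = 1) (by
        intro B hB
        cases hB
        exact rfl)
      omega
    · cases hs
      have h1 := h ({({PropFml.atom 0} : Set PropFml)} : Set (Set PropFml)) (by
        intro A hA
        cases hA
        intro hn
        refine (hn ?_).elim
        intro w hw
        cases hw
        exact PropLogic.refl _) _ rfl
      have h2 : (1 : ℕ) = 0 := h1 (fun n => n = 0) (by
        intro B hB
        cases hB
        exact rfl)
      omega

/-- Second No-Go Theorem: Over classical propositional logic,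
no continuous and non-refusing censor is at the same time effective and
minimally invasive. -/
theorem second_no_go (Cens : Censor PropLogic) :
    ¬ (ContinuousCensor Cens ∧ NonRefusing Cens ∧ Effective Cens ∧
        MinimallyInvasive Cens) := by
  rintro ⟨-, hr, he, -⟩
  have hr0 := hr badPK (fun _ => PropFml.atom 0) 0
  have he0 := he badPK (fun _ => PropFml.atom 0) 1
  cases hc : Cens badPK (fun _ => PropFml.atom 0) 0 with
  | r => exact hr0 hc
  | t =>
    refine he0 (PropFml.atom 0) (Or.inl rfl) fun M hM => ?_
    have h := hM _ (Or.inl ⟨0, Nat.one_pos, rfl⟩)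
    rw [hc] at h
    exact h
  | u =>
    refine he0 (PropFml.atom 1) (Or.inr rfl) fun M hM => ?_
    have h := hM _ (Or.inl ⟨0, Nat.one_pos, rfl⟩)
    rw [hc] at h
    exact hM _ (Or.inr rfl) h
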